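/- arXiv:1812.09320 — 6 statements merged into one kernel-verified Lean document; each statement's English description precedes it below -/
import Mathlib

section
/- For all real numbers 0 < λ < μ and α > 0, with ρ = λ/μ, the average linear cost of update delay of the M/M/1 FCFS queue satisfies λ · ∫_0^∞ α·( y·( e^{−(μ−λ)y}/(μ−λ) + 1/μ ) + y²/2 ) · λ e^{−λ y} dy = (α/μ)·( 1 + 1/ρ + ρ²/(1−ρ) ). (Here e^{−(μ−λ)y}/(μ−λ) + 1/μ is the conditional expected system time E[T | Y = y], so the left-hand side equals λ·E[α(Y·T + Y²/2)], the average CoUD C_P for f_s(t) = αt.) -/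
open MeasureTheory Real

theorem integral_pow_mul_exp_neg_mul_Ioi (n : ℕ) {r : ℝ} (hr : 0 < r) :
    ∫ y in Set.Ioi (0:ℝ), y ^ n * Real.exp (-r * y) = n.factorial / r ^ (n + 1) := by
  have h := Real.integral_rpow_mul_exp_neg_mul_Ioi (a := n + 1) (by positivity) hr
  rw [Real.Gamma_nat_eq_factorial] at h
  simp only [add_sub_cancel_right, Real.rpow_natCast, ← neg_mul] at h
  rw [h, ← Nat.cast_succ, Real.rpow_natCast, one_div, inv_pow]
  field_simp

theorem integrableOn_pow_mul_exp_neg_mul_Ioi (n : ℕ) {r : ℝ} (hr : 0 < r) :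
    IntegrableOn (fun y : ℝ => y ^ n * Real.exp (-r * y)) (Set.Ioi 0) := by
  refine Integrable.of_integral_ne_zero ?_
  rw [integral_pow_mul_exp_neg_mul_Ioi n hr]
  positivity

/-- Average linear CoUD of the M/M/1 FCFS queue:
`λ · E[α(Y·T + Y²/2)] = (α/μ)(1 + 1/ρ + ρ²/(1−ρ))` with `ρ = λ/μ`,
where `E[T | Y = y] = e^{−(μ−λ)y}/(μ−λ) + 1/μ` and `Y` is exponential of rate `λ`. -/
theorem avg_linear_CoUD (lam mu alpha : ℝ) (hlam : 0 < lam) (hlm : lam < mu)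
    (halpha : 0 < alpha) :
    lam * ∫ y in Set.Ioi (0:ℝ),
        alpha * (y * (Real.exp (-(mu - lam) * y) / (mu - lam) + 1 / mu) + y ^ 2 / 2) *
          (lam * Real.exp (-lam * y))
      = (alpha / mu) * (1 + 1 / (lam / mu) + (lam / mu) ^ 2 / (1 - lam / mu)) := by
  have hmu : 0 < mu := hlam.trans hlm
  have hsub : mu - lam ≠ 0 := (sub_pos.2 hlm).ne'
  have hexpand : ∀ y : ℝ,
      alpha * (y * (Real.exp (-(mu - lam) * y) / (mu - lam) + 1 / mu) + y ^ 2 / 2) *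
          (lam * Real.exp (-lam * y))
        = alpha * lam / (mu - lam) * (y ^ 1 * Real.exp (-mu * y))
          + alpha * lam / mu * (y ^ 1 * Real.exp (-lam * y))
          + alpha * lam / 2 * (y ^ 2 * Real.exp (-lam * y)) := by
    intro y
    have hexp : Real.exp (-mu * y) = Real.exp (-(mu - lam) * y) * Real.exp (-lam * y) := by
      rw [← Real.exp_add]
      ring_nf
    rw [hexp]
    ring
  have hint₁ := (integrableOn_pow_mul_exp_neg_mul_Ioi 1 hmu).const_mul (alpha * lam / (mu - lam))
  have hint₂ := (integrableOn_pow_mul_exp_neg_mul_Ioi 1 hlam).const_mul (alpha * lam / mu)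
  have hint₃ := (integrableOn_pow_mul_exp_neg_mul_Ioi 2 hlam).const_mul (alpha * lam / 2)
  simp_rw [hexpand]
  rw [integral_add (by exact hint₁.add hint₂) hint₃, integral_add hint₁ hint₂, integral_const_mul,
    integral_const_mul, integral_const_mul, integral_pow_mul_exp_neg_mul_Ioi 1 hmu,
    integral_pow_mul_exp_neg_mul_Ioi 1 hlam, integral_pow_mul_exp_neg_mul_Ioi 2 hlam]
  have hone : 1 - lam / mu = (mu - lam) / mu := by field_simp
  rw [hone]
  simp only [Nat.factorial]
  field_simp
  norm_num
  ring
end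

section
/- For all real numbers 0 < λ < μ, the covariance of the stationary system time T and the interarrival time Y in the M/M/1 FCFS queue equals −1/μ²; concretely, ∫_0^∞ y·( e^{−(μ−λ)y}/(μ−λ) + 1/μ )·λ e^{−λ y} dy − (1/λ)·(1/(μ−λ)) = −1/μ², where the integral equals E[T·Y] (with E[T | Y = y] = e^{−(μ−λ)y}/(μ−λ) + 1/μ) and 1/λ and 1/(μ−λ) are E[Y] and E[T] respectively. -/
open MeasureTheory Real

theorem integral_mul_exp_neg_mul_Ioi {r : ℝ} (hr : 0 < r) :
    ∫ y in Set.Ioi (0:ℝ), y * Real.exp (-r * y) = 1 / r ^ 2 := by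
  have h := Real.integral_rpow_mul_exp_neg_mul_Ioi (a := 2) two_pos hr
  norm_num [Real.Gamma_two] at h
  simpa using h

theorem integrableOn_mul_exp_neg_mul_Ioi {r : ℝ} (hr : 0 < r) :
    IntegrableOn (fun y : ℝ => y * Real.exp (-r * y)) (Set.Ioi 0) := by
  refine Integrable.of_integral_ne_zero ?_
  rw [integral_mul_exp_neg_mul_Ioi hr]
  positivity

/-- Covariance of the stationary system time `T` and the interarrival time `Y`
in the M/M/1 FCFS queue equals `−1/μ²`:
`E[T·Y] − E[Y]·E[T] = −1/μ²`, where `E[T | Y = y] = e^{−(μ−λ)y}/(μ−λ) + 1/μ`. -/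
theorem cov_systemTime_interarrival (lam mu : ℝ) (hlam : 0 < lam) (hlm : lam < mu) :
    (∫ y in Set.Ioi (0:ℝ),
        y * (Real.exp (-(mu - lam) * y) / (mu - lam) + 1 / mu) *
          (lam * Real.exp (-lam * y)))
      - (1 / lam) * (1 / (mu - lam)) = -(1 / mu ^ 2) := by
  have hmu : 0 < mu := hlam.trans hlm
  have hd : mu - lam ≠ 0 := (sub_pos.2 hlm).ne'
  have hsplit : ∀ y : ℝ,
      y * (Real.exp (-(mu - lam) * y) / (mu - lam) + 1 / mu) * (lam * Real.exp (-lam * y)) =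
        lam / (mu - lam) * (y * Real.exp (-mu * y)) + lam / mu * (y * Real.exp (-lam * y)) := by
    intro y
    have hexp : Real.exp (-mu * y) = Real.exp (-(mu - lam) * y) * Real.exp (-lam * y) := by
      rw [← Real.exp_add]
      ring_nf
    rw [hexp]
    ring
  simp_rw [hsplit]
  rw [integral_add ((integrableOn_mul_exp_neg_mul_Ioi hmu).const_mul _)
      ((integrableOn_mul_exp_neg_mul_Ioi hlam).const_mul _),
    integral_const_mul, integral_const_mul, integral_mul_exp_neg_mul_Ioi hmu,
    integral_mul_exp_neg_mul_Ioi hlam]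
  field_simp
  ring
end

section
/- For all real numbers 0 < λ < μ and 0 < α with α < λ and α < μ − λ, letting ρ = λ/μ, the average exponential CoUD of the M/M/1 FCFS system satisfies ∫_0^∞ (e^{α t} − 1)·C(t) dt = μ(ρ−1)·( α(α − (λ+μ)) / ( (λ−α)(α−μ)² ) + 1/(α − μ(1−ρ)) + 1/(μ(1−ρ)) ). -/
open MeasureTheory Real

theorem integrableOn_exp_neg_mul_Ioi_zero {r : ℝ} (hr : 0 < r) :
    IntegrableOn (fun t : ℝ => exp (-r * t)) (Set.Ioi 0) :=
  integrableOn_exp_mul_Ioi (neg_neg_of_pos hr) 0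

theorem integral_exp_neg_mul_Ioi_zero {r : ℝ} (hr : 0 < r) :
    ∫ t in Set.Ioi (0 : ℝ), exp (-r * t) = 1 / r := by
  rw [integral_exp_mul_Ioi (neg_neg_of_pos hr)]
  simp

theorem integrableOn_mul_exp_neg_mul_Ioi_zero {r : ℝ} (hr : 0 < r) :
    IntegrableOn (fun t : ℝ => t * exp (-r * t)) (Set.Ioi 0) := by
  simpa using integrableOn_rpow_mul_exp_neg_mul_rpow (p := 1) (s := 1) (by norm_num) one_pos hr

theorem integral_mul_exp_neg_mul_Ioi_zero {r : ℝ} (hr : 0 < r) :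
    ∫ t in Set.Ioi (0 : ℝ), t * exp (-r * t) = 1 / r ^ 2 := by
  have h := integral_rpow_mul_exp_neg_mul_Ioi (a := 2) two_pos hr
  norm_num [Gamma_two] at h
  simpa using h

/-- The stationary density of the CoUD process of the M/M/1 FCFS queue. -/
noncomputable def coudDensity (lam mu t : ℝ) : ℝ :=
  (lam ^ 2 / (lam - mu) - mu) * exp (-mu * t)
    + (lam * mu / (mu - lam)) * exp (-lam * t)
    - lam * mu * t * exp (-mu * t)
    + (mu - lam) * exp (-(mu - lam) * t)

theorem exp_mul_coudDensity (lam mu s t : ℝ) :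
    exp (s * t) * coudDensity lam mu t =
      (lam ^ 2 / (lam - mu) - mu) * exp (-(mu - s) * t)
        + (lam * mu / (mu - lam)) * exp (-(lam - s) * t)
        - lam * mu * (t * exp (-(mu - s) * t))
        + (mu - lam) * exp (-(mu - lam - s) * t) := by
  have h (r : ℝ) : exp (-(r - s) * t) = exp (s * t) * exp (-r * t) := by
    rw [← exp_add]
    ring_nf
  rw [coudDensity, h mu, h lam, h (mu - lam)]
  ring

/-- The moment generating function of the stationary CoUD, together with its convergence. -/
theorem integrableOn_and_integral_exp_mul_coudDensity {lam mu s : ℝ}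
    (hmu : s < mu) (hlam : s < lam) (hsub : s < mu - lam) :
    IntegrableOn (fun t => exp (s * t) * coudDensity lam mu t) (Set.Ioi 0) ∧
      ∫ t in Set.Ioi (0 : ℝ), exp (s * t) * coudDensity lam mu t =
        (lam ^ 2 / (lam - mu) - mu) * (1 / (mu - s))
          + (lam * mu / (mu - lam)) * (1 / (lam - s))
          - lam * mu * (1 / (mu - s) ^ 2)
          + (mu - lam) * (1 / (mu - lam - s)) := by
  simp only [exp_mul_coudDensity]
  have hmu' := sub_pos.2 hmu
  have hlam' := sub_pos.2 hlam
  have hsub' := sub_pos.2 hsub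
  have i₁ := (integrableOn_exp_neg_mul_Ioi_zero hmu').const_mul (lam ^ 2 / (lam - mu) - mu)
  have i₂ := (integrableOn_exp_neg_mul_Ioi_zero hlam').const_mul (lam * mu / (mu - lam))
  have i₃ := (integrableOn_mul_exp_neg_mul_Ioi_zero hmu').const_mul (lam * mu)
  have i₄ := (integrableOn_exp_neg_mul_Ioi_zero hsub').const_mul (mu - lam)
  refine ⟨((i₁.add i₂).sub i₃).add i₄, ?_⟩
  rw [integral_add (by exact (i₁.add i₂).sub i₃) i₄, integral_sub (by exact i₁.add i₂) i₃,
    integral_add i₁ i₂]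
  simp only [integral_const_mul]
  rw [integral_exp_neg_mul_Ioi_zero hmu', integral_exp_neg_mul_Ioi_zero hlam',
    integral_mul_exp_neg_mul_Ioi_zero hmu', integral_exp_neg_mul_Ioi_zero hsub']

/-- Average exponential CoUD of the M/M/1 FCFS queue, where
`C(t) = (λ²/(λ−μ) − μ)e^{−μt} + (λμ/(μ−λ))e^{−λt} − λμ t e^{−μt} + (μ−λ)e^{−(μ−λ)t}`
is the stationary CoUD density and `ρ = λ/μ`. -/
theorem avg_exponential_CoUD (lam mu alpha : ℝ) (hlam : 0 < lam) (hlm : lam < mu)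
    (halpha : 0 < alpha) (hal : alpha < lam) (ham : alpha < mu - lam) :
    (∫ t in Set.Ioi (0:ℝ), (Real.exp (alpha * t) - 1) *
        ((lam ^ 2 / (lam - mu) - mu) * Real.exp (-mu * t)
          + (lam * mu / (mu - lam)) * Real.exp (-lam * t)
          - lam * mu * t * Real.exp (-mu * t)
          + (mu - lam) * Real.exp (-(mu - lam) * t)))
      = mu * (lam / mu - 1) *
          (alpha * (alpha - (lam + mu)) / ((lam - alpha) * (alpha - mu) ^ 2)
            + 1 / (alpha - mu * (1 - lam / mu))
            + 1 / (mu * (1 - lam / mu))) := by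
  change ∫ t in Set.Ioi (0 : ℝ), (exp (alpha * t) - 1) * coudDensity lam mu t = _
  obtain ⟨ia, ha⟩ := integrableOn_and_integral_exp_mul_coudDensity (hal.trans hlm) hal ham
  obtain ⟨i0, h0⟩ := integrableOn_and_integral_exp_mul_coudDensity (s := 0)
    (hlam.trans hlm) hlam (halpha.trans ham)
  have hsplit (t : ℝ) : (exp (alpha * t) - 1) * coudDensity lam mu t =
      exp (alpha * t) * coudDensity lam mu t - exp (0 * t) * coudDensity lam mu t := by
    rw [zero_mul, exp_zero]
    ring
  simp only [hsplit]
  rw [integral_sub ia i0, ha, h0]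
  have hmu : mu ≠ 0 := (hlam.trans hlm).ne'
  have hrho : mu * (1 - lam / mu) = mu - lam := by field_simp
  have hrho' : mu * (lam / mu - 1) = -(mu - lam) := by field_simp; ring
  have e₁ : lam - mu = -(mu - lam) := by ring
  have e₂ : alpha - mu = -(mu - alpha) := by ring
  have e₃ : alpha - (mu - lam) = -(mu - lam - alpha) := by ring
  rw [hrho, hrho', e₁, e₂, e₃]
  have hl : lam ≠ 0 := hlam.ne'
  have n₁ : mu - lam ≠ 0 := (sub_pos.2 hlm).ne'
  have n₂ : mu - alpha ≠ 0 := (sub_pos.2 (hal.trans hlm)).ne'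
  have n₃ : mu - lam - alpha ≠ 0 := (sub_pos.2 ham).ne'
  have n₄ : lam - alpha ≠ 0 := (sub_pos.2 hal).ne'
  simp only [sub_zero]
  field_simp
  ring
end

section
/- For all real numbers 0 < λ < μ and 0 < α with α < λ and α < μ − λ, letting ρ = λ/μ, the average exponential CoUD of the M/M/1 FCFS queue is upper bounded as follows: μ(ρ−1)·( α(α − (λ+μ)) / ( (λ−α)(α−μ)² ) + 1/(α − μ(1−ρ)) + 1/(μ(1−ρ)) ) ≤ λ·(1/α)·( (μ(1−ρ)/(α − μ(1−ρ)))·( λ/(α−λ) + 1 ) ) − 1. -/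
/-- The average exponential CoUD of the M/M/1 FCFS queue is upper bounded by the
average exponential PCoUD bound `E[e^{α(Ȳ+T)} − 1]` computed with `Ȳ` independent of `T`,
with `ρ = λ/μ`. -/
theorem exponential_CoUD_le_bound (lam mu alpha : ℝ) (hlam : 0 < lam) (hlm : lam < mu)
    (halpha : 0 < alpha) (hal : alpha < lam) (ham : alpha < mu - lam) :
    mu * (lam / mu - 1) *
        (alpha * (alpha - (lam + mu)) / ((lam - alpha) * (alpha - mu) ^ 2)
          + 1 / (alpha - mu * (1 - lam / mu))
          + 1 / (mu * (1 - lam / mu)))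
      ≤ lam * (1 / alpha) *
          ((mu * (1 - lam / mu) / (alpha - mu * (1 - lam / mu))) * (lam / (alpha - lam) + 1))
        - 1 := by
  have hmu : mu ≠ 0 := by linarith
  have hd : 0 < mu - lam := by linarith
  have hla : 0 < lam - alpha := by linarith
  have hda : 0 < mu - lam - alpha := by linarith
  have hma : 0 < mu - alpha := by linarith
  have hone_sub : mu * (1 - lam / mu) = mu - lam := by field_simp
  have hsub_one : mu * (lam / mu - 1) = -(mu - lam) := by field_simp; ring
  rw [hone_sub, hsub_one, ← sub_nonneg]
  have gap_nonneg : 0 ≤ (mu - lam) * alpha * lam ^ 2 /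
      ((lam - alpha) * (mu - lam - alpha) * (mu - alpha) ^ 2) := by positivity
  convert gap_nonneg using 1
  have hneg_d : alpha - (mu - lam) = -(mu - lam - alpha) := by ring
  have hneg_l : alpha - lam = -(lam - alpha) := by ring
  have hneg_m : alpha - mu = -(mu - alpha) := by ring
  rw [hneg_d, hneg_l, hneg_m]
  field_simp
  ring
end

section
/- For all real numbers 0 < λ < μ and α > 0, letting ρ = λ/μ and writing Ei(−x) = −E1(x) for x > 0, the average logarithmic CoUD of the M/M/1 FCFS system satisfies ∫_0^∞ log(α t + 1)·C(t) dt = (1/(α(λ−μ)²))·( e^{−μρ/α}·( μ(1−ρ)·Ei(−μ/α)·(αμ + λ² − λμ)·e^{μ(ρ+1)/α} − αμ²(1−ρ)·Ei(−λ/α)·e^{(λ+μρ)/α} − α e^{μ/α}(λ−μ)²·Ei(−μ(1−ρ)/α) ) − αλ(1−ρ)(μ−λ) ). -/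
open MeasureTheory Real

/-- The exponential integral `E1 x = ∫_x^∞ e^{−t}/t dt`; the paper's `Ei` satisfies
`Ei (−x) = −E1 x` for `x > 0`. -/
noncomputable def E1 (x : ℝ) : ℝ := ∫ t in Set.Ioi x, Real.exp (-t) / t

open Filter Set Asymptotics Topology

lemma isBigO_pow_mul_log_mul_exp_neg {a c : ℝ} (ha : 0 < a) (hc : 0 < c) (n : ℕ) :
    (fun t : ℝ => t ^ n * (Real.log (a * t + 1) * Real.exp (-c * t)))
      =O[atTop] fun t => Real.exp (-(c / 2) * t) := by
  have hlog : (fun t : ℝ => Real.log (a * t + 1)) =O[atTop] fun t => t := by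
    refine IsBigO.of_bound a ?_
    filter_upwards [eventually_ge_atTop 0] with t ht
    have hat : 0 ≤ a * t := by positivity
    rw [Real.norm_of_nonneg (Real.log_nonneg (by linarith)), Real.norm_of_nonneg ht]
    linarith [Real.log_le_sub_one_of_pos (by linarith : 0 < a * t + 1)]
  have hpow : (fun t : ℝ => t ^ n * t) =O[atTop] fun t => Real.exp (c / 2 * t) := by
    simpa only [pow_succ] using (isLittleO_pow_exp_pos_mul_atTop (n + 1) (half_pos hc)).isBigO
  refine ((((isBigO_refl (fun t : ℝ => t ^ n) atTop).mul hlog).trans hpow).mul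
    (isBigO_refl (fun t : ℝ => Real.exp (-c * t)) atTop)).congr (fun t => by ring) (fun t => ?_)
  rw [← Real.exp_add]
  ring_nf

lemma integrableOn_pow_mul_log_mul_exp_neg {a c : ℝ} (ha : 0 < a) (hc : 0 < c) (n : ℕ) :
    IntegrableOn (fun t : ℝ => t ^ n * (Real.log (a * t + 1) * Real.exp (-c * t))) (Ioi 0) := by
  refine integrable_of_isBigO_exp_neg (half_pos hc) ?_ (isBigO_pow_mul_log_mul_exp_neg ha hc n)
  have hne : ∀ t ∈ Ici (0 : ℝ), a * t + 1 ≠ 0 := fun t ht => by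
    have : 0 ≤ a * t := mul_nonneg ha.le ht
    positivity
  fun_prop (disch := assumption)

lemma tendsto_pow_mul_log_mul_exp_neg {a c : ℝ} (ha : 0 < a) (hc : 0 < c) (n : ℕ) :
    Tendsto (fun t : ℝ => t ^ n * (Real.log (a * t + 1) * Real.exp (-c * t))) atTop (𝓝 0) :=
  (isBigO_pow_mul_log_mul_exp_neg ha hc n).trans_tendsto <|
    Real.tendsto_exp_atBot.comp <|
      tendsto_id.const_mul_atTop_of_neg (neg_lt_zero.mpr (half_pos hc))

lemma integrableOn_exp_neg_mul_div {a c : ℝ} (ha : 0 < a) (hc : 0 < c) :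
    IntegrableOn (fun t : ℝ => Real.exp (-c * t) * (a / (a * t + 1))) (Ioi 0) := by
  have hne : ∀ t ∈ Ici (0 : ℝ), a * t + 1 ≠ 0 := fun t ht => by
    have : 0 ≤ a * t := mul_nonneg ha.le ht
    positivity
  refine integrable_of_isBigO_exp_neg hc (by fun_prop (disch := assumption)) ?_
  refine IsBigO.of_bound a ?_
  filter_upwards [eventually_ge_atTop 0] with t ht
  have hat : 0 ≤ a * t := by positivity
  rw [norm_mul, mul_comm, Real.norm_of_nonneg (by positivity : 0 ≤ a / (a * t + 1))]
  gcongr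
  exact div_le_self ha.le (by linarith)

lemma integral_exp_neg_mul_div {a c : ℝ} (ha : 0 < a) (hc : 0 < c) :
    ∫ t in Ioi (0 : ℝ), Real.exp (-c * t) * (a / (a * t + 1))
      = Real.exp (c / a) * E1 (c / a) := by
  have hshift : ∫ t in Ioi (0 : ℝ), Real.exp (-(c * (t + 1 / a))) / (c * (t + 1 / a))
      = ∫ s in Ioi (1 / a), Real.exp (-(c * s)) / (c * s) := by
    have h := (measurePreserving_add_right volume (1 / a)).setIntegral_preimage_emb
      (measurableEmbedding_addRight (1 / a)) (fun s => Real.exp (-(c * s)) / (c * s)) (Ioi (1 / a))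
    simpa using h
  have hscale := integral_comp_mul_left_Ioi (fun u => Real.exp (-u) / u) (1 / a) hc
  rw [smul_eq_mul, mul_one_div] at hscale
  calc
    _ = ∫ t in Ioi (0 : ℝ), c * Real.exp (c / a) *
          (Real.exp (-(c * (t + 1 / a))) / (c * (t + 1 / a))) := by
      refine setIntegral_congr_fun measurableSet_Ioi fun t ht => ?_
      have ht' : 0 < t := ht
      have hexp : Real.exp (-c * t) = Real.exp (c / a) * Real.exp (-(c * (t + 1 / a))) := by
        rw [← Real.exp_add]
        ring_nf
      simp only [hexp]
      field_simp
    _ = c * Real.exp (c / a) * (c⁻¹ * E1 (c / a)) := by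
      rw [integral_const_mul, hshift, hscale, E1]
    _ = _ := by field_simp

lemma hasDerivAt_log_mul_add_one {a t : ℝ} (ha : 0 < a) (ht : 0 ≤ t) :
    HasDerivAt (fun t : ℝ => Real.log (a * t + 1)) (a / (a * t + 1)) t := by
  have hne : a * t + 1 ≠ 0 := by positivity
  simpa using (((hasDerivAt_id t).const_mul a).add_const 1).log hne

lemma hasDerivAt_exp_neg_mul (c t : ℝ) :
    HasDerivAt (fun t : ℝ => Real.exp (-c * t)) (-c * Real.exp (-c * t)) t := by
  simpa [mul_comm] using ((hasDerivAt_id t).const_mul (-c)).exp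

lemma integral_log_mul_exp_neg {a c : ℝ} (ha : 0 < a) (hc : 0 < c) :
    ∫ t in Ioi (0 : ℝ), Real.log (a * t + 1) * Real.exp (-c * t)
      = Real.exp (c / a) * E1 (c / a) / c := by
  have hint : IntegrableOn (fun t : ℝ => Real.log (a * t + 1) * Real.exp (-c * t)) (Ioi 0) := by
    simpa using integrableOn_pow_mul_log_mul_exp_neg ha hc 0
  have hK := integrableOn_exp_neg_mul_div ha hc
  have hlim : Tendsto (fun t : ℝ => Real.log (a * t + 1) * Real.exp (-c * t)) atTop (𝓝 0) := by
    simpa using tendsto_pow_mul_log_mul_exp_neg ha hc 0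
  have h := integral_Ioi_of_hasDerivAt_of_tendsto' (a := (0 : ℝ))
    (f' := fun t => Real.exp (-c * t) * (a / (a * t + 1))
      - c * (Real.log (a * t + 1) * Real.exp (-c * t)))
    (fun t ht => (((hasDerivAt_log_mul_add_one ha ht).mul
      (hasDerivAt_exp_neg_mul c t)).congr_deriv (by ring))) (hK.sub (hint.const_mul c)) hlim
  rw [integral_sub hK (hint.const_mul c), integral_const_mul, integral_exp_neg_mul_div ha hc] at h
  rw [eq_div_iff hc.ne']
  simp only [Pi.mul_apply, mul_zero, zero_add, Real.log_one, zero_mul, sub_zero] at h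
  linarith

lemma integral_mul_log_mul_exp_neg {a c : ℝ} (ha : 0 < a) (hc : 0 < c) :
    ∫ t in Ioi (0 : ℝ), t * (Real.log (a * t + 1) * Real.exp (-c * t))
      = Real.exp (c / a) * E1 (c / a) * (1 / c ^ 2 - 1 / (a * c)) + 1 / c ^ 2 := by
  have hint : IntegrableOn (fun t : ℝ => Real.log (a * t + 1) * Real.exp (-c * t)) (Ioi 0) := by
    simpa using integrableOn_pow_mul_log_mul_exp_neg ha hc 0
  have hint' : IntegrableOn
      (fun t : ℝ => t * (Real.log (a * t + 1) * Real.exp (-c * t))) (Ioi 0) := by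
    simpa using integrableOn_pow_mul_log_mul_exp_neg ha hc 1
  have hK := (integrableOn_exp_neg_mul_div ha hc).const_mul (1 / a)
  have hE : IntegrableOn (fun t : ℝ => Real.exp (-c * t)) (Ioi 0) :=
    integrableOn_exp_mul_Ioi (neg_lt_zero.mpr hc) 0
  have hlim : Tendsto (fun t : ℝ => t * (Real.log (a * t + 1) * Real.exp (-c * t)))
      atTop (𝓝 0) := by
    simpa using tendsto_pow_mul_log_mul_exp_neg ha hc 1
  have h := integral_Ioi_of_hasDerivAt_of_tendsto' (a := (0 : ℝ))
    (f' := fun t => (Real.log (a * t + 1) * Real.exp (-c * t)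
        + (Real.exp (-c * t) - 1 / a * (Real.exp (-c * t) * (a / (a * t + 1)))))
      - c * (t * (Real.log (a * t + 1) * Real.exp (-c * t))))
    (fun t ht => (((hasDerivAt_id t).mul ((hasDerivAt_log_mul_add_one ha ht).mul
      (hasDerivAt_exp_neg_mul c t))).congr_deriv (by
        have ht' : 0 ≤ t := ht
        simp only [id, Pi.mul_apply]
        field_simp
        ring)))
    ((hint.add (hE.sub hK)).sub (hint'.const_mul c)) hlim
  rw [integral_sub (hint.fun_add (hE.fun_sub hK)) (hint'.const_mul c),
    integral_add hint (hE.fun_sub hK), integral_sub hE hK, integral_const_mul, integral_const_mul,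
    integral_exp_neg_mul_div ha hc, integral_log_mul_exp_neg ha hc,
    integral_exp_mul_Ioi (neg_lt_zero.mpr hc)] at h
  simp only [Pi.mul_apply, id, mul_zero, zero_mul, sub_zero, Real.exp_zero, neg_div_neg_eq] at h
  rw [← mul_right_inj' hc.ne']
  field_simp at h ⊢
  linarith


/-- Average logarithmic CoUD of the M/M/1 FCFS queue (Theorem 3), with `ρ = λ/μ` and
`Ei(−x) = −E1(x)`. -/
theorem avg_logarithmic_CoUD (lam mu alpha : ℝ) (hlam : 0 < lam) (hlm : lam < mu)
    (halpha : 0 < alpha) :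
    (∫ t in Set.Ioi (0:ℝ), Real.log (alpha * t + 1) *
        ((lam ^ 2 / (lam - mu) - mu) * Real.exp (-mu * t)
          + (lam * mu / (mu - lam)) * Real.exp (-lam * t)
          - lam * mu * t * Real.exp (-mu * t)
          + (mu - lam) * Real.exp (-(mu - lam) * t)))
      = (1 / (alpha * (lam - mu) ^ 2)) *
          (Real.exp (-(mu * (lam / mu)) / alpha) *
            (mu * (1 - lam / mu) * (-E1 (mu / alpha)) * (alpha * mu + lam ^ 2 - lam * mu)
                * Real.exp (mu * (lam / mu + 1) / alpha)
              - alpha * mu ^ 2 * (1 - lam / mu) * (-E1 (lam / alpha))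
                * Real.exp ((lam + mu * (lam / mu)) / alpha)
              - alpha * Real.exp (mu / alpha) * (lam - mu) ^ 2
                * (-E1 (mu * (1 - lam / mu) / alpha)))
            - alpha * lam * (1 - lam / mu) * (mu - lam)) := by
  have hmu : 0 < mu := hlam.trans hlm
  have hd : 0 < mu - lam := sub_pos.mpr hlm
  have hint : ∀ {c : ℝ}, 0 < c → IntegrableOn
      (fun t : ℝ => Real.log (alpha * t + 1) * Real.exp (-c * t)) (Ioi 0) := fun hc => by
    simpa using integrableOn_pow_mul_log_mul_exp_neg halpha hc 0
  have hint' : IntegrableOn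
      (fun t : ℝ => t * (Real.log (alpha * t + 1) * Real.exp (-mu * t))) (Ioi 0) := by
    simpa using integrableOn_pow_mul_log_mul_exp_neg halpha hmu 1
  have hA := (hint hmu).const_mul (lam ^ 2 / (lam - mu) - mu)
  have hB := (hint hlam).const_mul (lam * mu / (mu - lam))
  have hC := hint'.const_mul (lam * mu)
  have hD := (hint hd).const_mul (mu - lam)
  have hsplit : ∀ t : ℝ, Real.log (alpha * t + 1) *
        ((lam ^ 2 / (lam - mu) - mu) * Real.exp (-mu * t)
          + (lam * mu / (mu - lam)) * Real.exp (-lam * t)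
          - lam * mu * t * Real.exp (-mu * t)
          + (mu - lam) * Real.exp (-(mu - lam) * t))
      = (lam ^ 2 / (lam - mu) - mu) * (Real.log (alpha * t + 1) * Real.exp (-mu * t))
          + (lam * mu / (mu - lam)) * (Real.log (alpha * t + 1) * Real.exp (-lam * t))
          - lam * mu * (t * (Real.log (alpha * t + 1) * Real.exp (-mu * t)))
          + (mu - lam) * (Real.log (alpha * t + 1) * Real.exp (-(mu - lam) * t)) :=
    fun t => by ring
  simp_rw [hsplit]
  rw [integral_add (IntegrableOn.fun_sub (hA.fun_add hB) hC) hD,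
    integral_sub (hA.fun_add hB) hC, integral_add hA hB]
  simp_rw [integral_const_mul]
  rw [integral_log_mul_exp_neg halpha hmu, integral_log_mul_exp_neg halpha hlam,
    integral_log_mul_exp_neg halpha hd, integral_mul_log_mul_exp_neg halpha hmu]
  have hrho : mu * (lam / mu) = lam := mul_div_cancel₀ lam hmu.ne'
  have hcompl : mu * (1 - lam / mu) = mu - lam := by rw [mul_sub, hrho, mul_one]
  have hsum : mu * (lam / mu + 1) = lam + mu := by rw [mul_add, hrho, mul_one]
  have hexp : ∀ x y : ℝ,
      Real.exp (x / alpha) = Real.exp (-y / alpha) * Real.exp ((x + y) / alpha) :=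
    fun x y => by
      rw [← Real.exp_add]
      ring_nf
  have hexp_sub : Real.exp ((mu - lam) / alpha)
      = Real.exp (-lam / alpha) * Real.exp (mu / alpha) := by
    rw [hexp (mu - lam) lam, sub_add_cancel]
  rw [hcompl, hsum, hrho, hexp_sub, hexp lam lam, add_comm lam mu]
  have hne : lam - mu ≠ 0 := by linarith
  have hne' : mu - lam ≠ 0 := hd.ne'
  rw [hexp mu lam]
  field_simp
  ring
end

section
/- For all real numbers μ > 0 and α > 0, writing Ei(−x) = −E1(x) for x > 0, the function λ ↦ e^{(μ−λ)/α}·( λ·Ei((λ−μ)/α) + (λ−μ)·Ei(−λ/α)·e^{(2λ−μ)/α} ) / ( λ(μ−2λ) ), defined for λ ∈ (0, μ) with λ ≠ μ/2, tends to ( 2α − e^{μ/(2α)}·(2α−μ)·Ei(−μ/(2α)) ) / (αμ) as λ → μ/2. -/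
open MeasureTheory Real Filter

theorem integrableOn_exp_neg_div_Ioi {c : ℝ} (hc : 0 < c) :
    IntegrableOn (fun t : ℝ => Real.exp (-t) / t) (Set.Ioi c) := by
  refine Integrable.mono' ((integrableOn_exp_neg_Ioi c).div_const c) ?_ ?_
  · exact Measurable.aestronglyMeasurable (by fun_prop)
  · refine (ae_restrict_iff' measurableSet_Ioi).2 (ae_of_all _ fun t ht => ?_)
    have hct : c < t := ht
    have ht0 : 0 < t := hc.trans hct
    rw [Real.norm_of_nonneg (by positivity)]
    gcongr

theorem hasDerivAt_E1 {x : ℝ} (hx : 0 < x) :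
    HasDerivAt E1 (-(Real.exp (-x) / x)) x := by
  have hc : 0 < x / 2 := half_pos hx
  have hI := integrableOn_exp_neg_div_Ioi hc
  have hcont : ContinuousOn (fun t : ℝ => Real.exp (-t) / t) (Set.Ioi 0) :=
    ContinuousOn.div (by fun_prop) continuousOn_id fun t ht => ne_of_gt ht
  have hderiv : HasDerivAt (fun u => ∫ t in (x / 2)..u, Real.exp (-t) / t)
      (Real.exp (-x) / x) x := by
    refine intervalIntegral.integral_hasDerivAt_right ?_ ?_
      (hcont.continuousAt (Ioi_mem_nhds hx))
    · exact (intervalIntegrable_iff_integrableOn_Ioc_of_le (by linarith)).2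
        (hI.mono_set Set.Ioc_subset_Ioi_self)
    · exact hcont.stronglyMeasurableAtFilter isOpen_Ioi x hx
  refine (hderiv.const_sub (E1 (x / 2))).congr_of_eventuallyEq ?_
  filter_upwards [Ioi_mem_nhds (half_lt_self hx)] with u hu
  have h := intervalIntegral.integral_interval_add_Ioi hI
    (integrableOn_exp_neg_div_Ioi (hc.trans hu))
  simp only [E1]
  linarith

/-- Derivative of the scaled exponential integral `x ↦ e^{x/α} E1 (x/α)`. -/
theorem hasDerivAt_exp_mul_E1 {alpha x : ℝ} (halpha : 0 < alpha) (hx : 0 < x) :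
    HasDerivAt (fun y => Real.exp (y / alpha) * E1 (y / alpha))
      (Real.exp (x / alpha) * E1 (x / alpha) / alpha - 1 / x) x := by
  have hd : HasDerivAt (fun y : ℝ => y / alpha) (1 / alpha) x := (hasDerivAt_id x).div_const alpha
  have hE := (hasDerivAt_E1 (div_pos hx halpha)).comp x hd
  refine (hd.exp.mul hE).congr_deriv ?_
  have h : Real.exp (x / alpha) ≠ 0 := Real.exp_ne_zero _
  simp only [Function.comp_apply, Real.exp_neg]
  field_simp
  ring

/-- The logarithmic PCoUD per-update upper bound
`λ ↦ e^{(μ−λ)/α}( λ Ei((λ−μ)/α) + (λ−μ) Ei(−λ/α) e^{(2λ−μ)/α} ) / (λ(μ−2λ))`,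
defined on `(0, μ) \ {μ/2}`, tends to
`( 2α − e^{μ/(2α)}(2α−μ) Ei(−μ/(2α)) ) / (αμ)` as `λ → μ/2`
(with `Ei(−x) = −E1(x)`). -/
theorem logarithmic_bound_limit (mu alpha : ℝ) (hmu : 0 < mu) (halpha : 0 < alpha) :
    Filter.Tendsto
      (fun lam : ℝ =>
        Real.exp ((mu - lam) / alpha) *
            (lam * (-E1 ((mu - lam) / alpha))
              + (lam - mu) * (-E1 (lam / alpha)) * Real.exp ((2 * lam - mu) / alpha))
          / (lam * (mu - 2 * lam)))
      (nhdsWithin (mu / 2) (Set.Ioo 0 mu \ {mu / 2}))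
      (nhds ((2 * alpha - Real.exp (mu / (2 * alpha)) * (2 * alpha - mu) * (-E1 (mu / (2 * alpha))))
        / (alpha * mu))) := by
  set g : ℝ → ℝ := fun y => Real.exp (y / alpha) * E1 (y / alpha) with hg
  have hm : 0 < mu / 2 := half_pos hmu
  have hgm := hasDerivAt_exp_mul_E1 halpha hm
  have hrefl : HasDerivAt (fun y : ℝ => mu - y) (-1) (mu / 2) :=
    (hasDerivAt_id (mu / 2)).const_sub mu
  have hgr : HasDerivAt (fun y => g (mu - y)) _ (mu / 2) :=
    HasDerivAt.comp (h₂ := g) (mu / 2) (by rw [sub_half]; exact hgm) hrefl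
  have hN := (hrefl.mul hgm).sub ((hasDerivAt_id (mu / 2)).mul hgr)
  have hslope := (hasDerivAt_iff_tendsto_slope.1 hN).mono_left
    (nhdsWithin_mono (mu / 2) (fun y (hy : y ∈ Set.Ioo 0 mu \ {mu / 2}) => hy.2))
  have hden : Tendsto (fun y : ℝ => -2 * y) (nhdsWithin (mu / 2) (Set.Ioo 0 mu \ {mu / 2}))
      (nhds (-2 * (mu / 2))) :=
    (Continuous.tendsto (by fun_prop) _).mono_left nhdsWithin_le_nhds
  have hlim := hslope.div hden (by linarith)
  have hhalf : mu / (2 * alpha) = mu / 2 / alpha := by field_simp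
  convert hlim.congr fun y => ?_ using 2
  · simp only [hg, id, sub_half, hhalf]
    field_simp
    ring
  · have hexp : Real.exp (y / alpha) =
        Real.exp ((mu - y) / alpha) * Real.exp ((2 * y - mu) / alpha) := by
      rw [← Real.exp_add]; congr 1; ring
    have hfac : y * (mu - 2 * y) = (y - mu / 2) * (-2 * y) := by ring
    simp only [Pi.div_apply, slope_def_field, Pi.sub_apply, Pi.mul_apply, id, hg, sub_half,
      sub_self, sub_zero]
    rw [div_div, hfac, hexp]
    congr 1
    ring
end
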